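/- The set of singular points of 𝒳, i.e. the set of complex lines ℂ·p spanned by nonzero singular points p of C𝒳, is finite and has exactly 96 elements. -/

import Mathlib

/-- The defining polynomials `F₀, F₁, F₂, F₃` in the variables
`Y₀,Y₁,Y₂,Y₃,X₀,X₁,X₂,X₃` (variable `i` for `i < 4` is `Yᵢ`, variable `4+i`
is `Xᵢ`). -/
noncomputable def vgnF : Fin 4 → MvPolynomial (Fin 8) ℂ
  | 0 => MvPolynomial.X 0 ^ 2 -
      (MvPolynomial.X 4 ^ 2 + MvPolynomial.X 5 ^ 2 + MvPolynomial.X 6 ^ 2 + MvPolynomial.X 7 ^ 2)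
  | 1 => MvPolynomial.X 1 ^ 2 -
      (MvPolynomial.X 4 ^ 2 - MvPolynomial.X 5 ^ 2 + MvPolynomial.X 6 ^ 2 - MvPolynomial.X 7 ^ 2)
  | 2 => MvPolynomial.X 2 ^ 2 -
      (MvPolynomial.X 4 ^ 2 + MvPolynomial.X 5 ^ 2 - MvPolynomial.X 6 ^ 2 - MvPolynomial.X 7 ^ 2)
  | 3 => MvPolynomial.X 3 ^ 2 -
      (MvPolynomial.X 4 ^ 2 - MvPolynomial.X 5 ^ 2 - MvPolynomial.X 6 ^ 2 + MvPolynomial.X 7 ^ 2)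

/-- The affine cone `C𝒳 ⊆ ℂ⁸`: the common zero set of `F₀, F₁, F₂, F₃`. -/
def coneX : Set (Fin 8 → ℂ) :=
  {p | ∀ i : Fin 4, MvPolynomial.eval p (vgnF i) = 0}

/-- The Jacobian matrix of `(F₀,F₁,F₂,F₃)` at a point `p`. -/
noncomputable def vgnJacobian (p : Fin 8 → ℂ) : Matrix (Fin 4) (Fin 8) ℂ :=
  Matrix.of fun i j => MvPolynomial.eval p (MvPolynomial.pderiv j (vgnF i))

/-- A nonzero point `p ∈ C𝒳` is a singular point if the Jacobian matrix of
`(F₀,F₁,F₂,F₃)` at `p` has rank `< 4`. -/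
def IsSingPt (p : Fin 8 → ℂ) : Prop :=
  p ≠ 0 ∧ p ∈ coneX ∧ (vgnJacobian p).rank < 4


lemma sing_iff (p : Fin 8 → ℂ) : IsSingPt p ↔ p ≠ 0 ∧
    (p 0 ^ 2 = p 4 ^ 2 + p 5 ^ 2 + p 6 ^ 2 + p 7 ^ 2 ∧
     p 1 ^ 2 = p 4 ^ 2 - p 5 ^ 2 + p 6 ^ 2 - p 7 ^ 2 ∧
     p 2 ^ 2 = p 4 ^ 2 + p 5 ^ 2 - p 6 ^ 2 - p 7 ^ 2 ∧
     p 3 ^ 2 = p 4 ^ 2 - p 5 ^ 2 - p 6 ^ 2 + p 7 ^ 2) ∧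
    ∃ a b c d : ℂ, ¬ (a = 0 ∧ b = 0 ∧ c = 0 ∧ d = 0) ∧
      a * p 0 = 0 ∧ b * p 1 = 0 ∧ c * p 2 = 0 ∧ d * p 3 = 0 ∧
      (a + b + c + d) * p 4 = 0 ∧ (a - b + c - d) * p 5 = 0 ∧
      (a + b - c - d) * p 6 = 0 ∧ (a - b - c + d) * p 7 = 0 := by
  have hrank : (vgnJacobian p).rank < 4 ↔ ¬ LinearIndependent ℂ (vgnJacobian p).row := by
    rw [linearIndependent_iff_card_eq_finrank_span, Set.finrank, ← Matrix.rank_eq_finrank_span_row]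
    have := Matrix.rank_le_height (vgnJacobian p)
    simp only [Fintype.card_fin]
    omega
  unfold IsSingPt
  rw [hrank, Fintype.not_linearIndependent_iff]
  refine and_congr Iff.rfl (and_congr ?_ ?_)
  · simp [coneX, Fin.forall_fin_succ, vgnF, sub_eq_zero]
  · have key : ∀ g : Fin 4 → ℂ, (∑ i, g i • (vgnJacobian p).row i = 0) ↔
        (g 0 * p 0 = 0 ∧ g 1 * p 1 = 0 ∧ g 2 * p 2 = 0 ∧ g 3 * p 3 = 0 ∧
      (g 0 + g 1 + g 2 + g 3) * p 4 = 0 ∧ (g 0 - g 1 + g 2 - g 3) * p 5 = 0 ∧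
      (g 0 + g 1 - g 2 - g 3) * p 6 = 0 ∧ (g 0 - g 1 - g 2 + g 3) * p 7 = 0) := by
      intro g
      rw [funext_iff]
      simp [Fin.forall_fin_succ, Fin.sum_univ_succ, vgnJacobian, vgnF, MvPolynomial.pderiv_X, Matrix.row, Pi.single_apply]
      intro _ _ _ _
      have hconv : ∀ u v q : ℂ, u = -2 * (v * q) → (u = 0 ↔ v = 0 ∨ q = 0) := by
        rintro u v q rfl
        simp
      exact and_congr (hconv _ _ _ (by ring)) (and_congr (hconv _ _ _ (by ring))
        (and_congr (hconv _ _ _ (by ring)) (hconv _ _ _ (by ring))))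
    constructor
    · rintro ⟨g, h, i, hi⟩
      refine ⟨g 0, g 1, g 2, g 3, ?_, (key g).1 h⟩
      rintro ⟨h0, h1, h2, h3⟩
      fin_cases i <;> simp_all
    · rintro ⟨a, b, c, d, hn, h⟩
      refine ⟨![a, b, c, d], (key _).2 (by simpa using h), ?_⟩
      by_contra hc
      push Not at hc
      exact hn ⟨hc 0, hc 1, hc 2, hc 3⟩

/-- first nonzero index -/
def pJ : Fin 6 → Fin 4 := ![0, 0, 0, 1, 1, 2]
/-- second nonzero index -/
def pK : Fin 6 → Fin 4 := ![1, 2, 3, 2, 3, 3]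
/-- signs -/
def hs : Fin 4 → Fin 4 → ℤ := ![![1, 1, 1, 1], ![1, -1, 1, -1], ![1, 1, -1, -1], ![1, -1, -1, 1]]

/-- normalisation -/
def NormPt (p : Fin 8 → ℂ) : Prop :=
  p 4 = 1 ∨ (p 4 = 0 ∧ p 5 = 1) ∨ (p 4 = 0 ∧ p 5 = 0 ∧ p 6 = 1)

/-- two nonzero coordinates -/
def Good (p : Fin 8 → ℂ) (t : Fin 6) (x : ℂ) : Prop :=
  x ^ 4 = 1 ∧ (∀ m : Fin 4, p (Fin.natAdd 4 m) = if m = pJ t then 1 else if m = pK t then x else 0) ∧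
  ∀ i : Fin 4, p (Fin.castAdd 4 i) ^ 2 = (hs i (pJ t) : ℂ) + hs i (pK t) * x ^ 2

lemma had_zero {a b c d : ℂ} (h1 : a + b + c + d = 0) (h2 : a - b + c - d = 0)
    (h3 : a + b - c - d = 0) (h4 : a - b - c + d = 0) : a = 0 ∧ b = 0 ∧ c = 0 ∧ d = 0 := by
  refine ⟨?_, ?_, ?_, ?_⟩
  · linear_combination (h1 + h2 + h3 + h4) / 4
  · linear_combination (h1 - h2 + h3 - h4) / 4
  · linear_combination (h1 + h2 - h3 - h4) / 4
  · linear_combination (h1 - h2 - h3 + h4) / 4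

lemma good_of_sing (p : Fin 8 → ℂ) (hp : IsSingPt p) (hN : NormPt p) :
    ∃ t x, Good p t x := by
  rw [sing_iff] at hp
  obtain ⟨h0, ⟨e0, e1, e2, e3⟩, a, b, c, d, hne, ha, hb, hc, hd, m0, m1, m2, m3⟩ := hp
  have one : p 0 ≠ 0 → p 1 ≠ 0 → p 2 ≠ 0 → p 3 ≠ 0 → False := by
    intro n0 n1 n2 n3
    exact hne ⟨(mul_eq_zero.1 ha).resolve_right n0, (mul_eq_zero.1 hb).resolve_right n1,
      (mul_eq_zero.1 hc).resolve_right n2, (mul_eq_zero.1 hd).resolve_right n3⟩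
  have fin : ∀ x : ℂ,
      (p 0 ^ 2 = 1 + x ^ 2 ∨ p 0 ^ 2 = 1 - x ^ 2 ∨ p 0 ^ 2 = -1 + x ^ 2 ∨ p 0 ^ 2 = -1 - x ^ 2) →
      (p 1 ^ 2 = 1 + x ^ 2 ∨ p 1 ^ 2 = 1 - x ^ 2 ∨ p 1 ^ 2 = -1 + x ^ 2 ∨ p 1 ^ 2 = -1 - x ^ 2) →
      (p 2 ^ 2 = 1 + x ^ 2 ∨ p 2 ^ 2 = 1 - x ^ 2 ∨ p 2 ^ 2 = -1 + x ^ 2 ∨ p 2 ^ 2 = -1 - x ^ 2) →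
      (p 3 ^ 2 = 1 + x ^ 2 ∨ p 3 ^ 2 = 1 - x ^ 2 ∨ p 3 ^ 2 = -1 + x ^ 2 ∨ p 3 ^ 2 = -1 - x ^ 2) →
      x ^ 4 = 1 := by
    intro x h0 h1 h2 h3
    by_contra hx
    have aux : ∀ y : ℂ, (y ^ 2 = 1 + x ^ 2 ∨ y ^ 2 = 1 - x ^ 2 ∨ y ^ 2 = -1 + x ^ 2 ∨
        y ^ 2 = -1 - x ^ 2) → y ≠ 0 := by
      rintro y h rfl
      apply hx
      rcases h with h | h | h | h
      · linear_combination (1 - x ^ 2) * h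
      · linear_combination (1 + x ^ 2) * h
      · linear_combination (-1 - x ^ 2) * h
      · linear_combination (x ^ 2 - 1) * h
    exact one (aux _ h0) (aux _ h1) (aux _ h2) (aux _ h3)
  have three : ∀ v : ℂ, a ^ 2 = v ^ 2 → b ^ 2 = v ^ 2 → c ^ 2 = v ^ 2 → d ^ 2 = v ^ 2 → False := by
    intro v ha' hb' hc' hd'
    by_cases hv : v = 0
    · subst hv; apply hne; exact ⟨by simpa using ha', by simpa using hb', by simpa using hc', by simpa using hd'⟩
    · have na : a ≠ 0 := by rintro rfl; apply hv; simpa using ha'.symm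
      have nb : b ≠ 0 := by rintro rfl; apply hv; simpa using hb'.symm
      have nc : c ≠ 0 := by rintro rfl; apply hv; simpa using hc'.symm
      have nd : d ≠ 0 := by rintro rfl; apply hv; simpa using hd'.symm
      have y0 : p 0 = 0 := by simpa [na] using ha
      have y1 : p 1 = 0 := by simpa [nb] using hb
      have y2 : p 2 = 0 := by simpa [nc] using hc
      have y3 : p 3 = 0 := by simpa [nd] using hd
      rw [y0] at e0
      rw [y1] at e1
      rw [y2] at e2
      rw [y3] at e3
      obtain ⟨z4, z5, z6, z7⟩ := had_zero (a := p 4 ^ 2) (b := p 5 ^ 2) (c := p 6 ^ 2) (d := p 7 ^ 2)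
        (by linear_combination -e0) (by linear_combination -e1)
        (by linear_combination -e2) (by linear_combination -e3)
      have w4 : p 4 = 0 := by simpa using z4
      have w5 : p 5 = 0 := by simpa using z5
      have w6 : p 6 = 0 := by simpa using z6
      have w7 : p 7 = 0 := by simpa using z7
      apply h0
      ext i
      fin_cases i <;> assumption
  have mk : ∀ (t : Fin 6) (x : ℂ),
      (∀ m : Fin 4, p (Fin.natAdd 4 m) = if m = pJ t then 1 else if m = pK t then x else 0) →
      Good p t x := by
    intro t x hX
    have x4 : p 4 = _ := hX 0
    have x5 : p 5 = _ := hX 1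
    have x6 : p 6 = _ := hX 2
    have x7 : p 7 = _ := hX 3
    rw [x4, x5, x6, x7] at e0 e1 e2 e3
    have hY : ∀ i : Fin 4, p (Fin.castAdd 4 i) ^ 2 = (hs i (pJ t) : ℂ) + hs i (pK t) * x ^ 2 := by
      intro i
      fin_cases i
      · refine Eq.trans e0 ?_
        fin_cases t <;> simp [pJ, pK, hs]
      · refine Eq.trans e1 ?_
        fin_cases t <;> simp [pJ, pK, hs] <;> ring
      · refine Eq.trans e2 ?_
        fin_cases t <;> simp [pJ, pK, hs] <;> ring
      · refine Eq.trans e3 ?_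
        fin_cases t <;> simp [pJ, pK, hs] <;> ring
    refine ⟨?_, hX, hY⟩
    have sg : ∀ i t, (hs i (pJ t) = 1 ∧ hs i (pK t) = 1) ∨ (hs i (pJ t) = 1 ∧ hs i (pK t) = -1) ∨
      (hs i (pJ t) = -1 ∧ hs i (pK t) = 1) ∨ (hs i (pJ t) = -1 ∧ hs i (pK t) = -1) := by decide
    have hY' : ∀ i : Fin 4, (p (Fin.castAdd 4 i) ^ 2 = 1 + x ^ 2 ∨ p (Fin.castAdd 4 i) ^ 2 = 1 - x ^ 2 ∨
      p (Fin.castAdd 4 i) ^ 2 = -1 + x ^ 2 ∨ p (Fin.castAdd 4 i) ^ 2 = -1 - x ^ 2) := by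
      intro i
      rw [hY i]
      rcases sg i t with ⟨h, h'⟩ | ⟨h, h'⟩ | ⟨h, h'⟩ | ⟨h, h'⟩ <;> rw [h, h']
      · left; push_cast; ring
      · right; left; push_cast; ring
      · right; right; left; push_cast; ring
      · right; right; right; push_cast; ring
    exact fin x (hY' 0) (hY' 1) (hY' 2) (hY' 3)
  have mk' : ∀ (t : Fin 6) (x : ℂ),
      p 4 = (if 0 = pJ t then 1 else if 0 = pK t then x else 0) →
      p 5 = (if 1 = pJ t then 1 else if 1 = pK t then x else 0) →
      p 6 = (if 2 = pJ t then 1 else if 2 = pK t then x else 0) →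
      p 7 = (if 3 = pJ t then 1 else if 3 = pK t then x else 0) → ∃ t x, Good p t x := by
    intro t x x4 x5 x6 x7
    refine ⟨t, x, mk t x ?_⟩
    intro m
    fin_cases m
    · exact x4
    · exact x5
    · exact x6
    · exact x7
  have nz : ∀ y z : ℂ, y ^ 2 = z → z ≠ 0 → y ≠ 0 := by
    rintro y z h hz rfl
    apply hz; rw [← h]; simp
  have cancel : ∀ y z : ℂ, z * y = 0 → y ≠ 0 → z = 0 := fun y z h hy =>
    (mul_eq_zero.1 h).resolve_right hy
  by_cases h4 : p 4 = 0 <;> by_cases h5 : p 5 = 0 <;> by_cases h6 : p 6 = 0 <;>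
    by_cases h7 : p 7 = 0
  -- 0000
  · exfalso; simp [NormPt, h4, h5, h6] at hN
  · exfalso; simp [NormPt, h4, h5, h6] at hN
  · exfalso; simp only [h4, h5, h7] at e0 e1 e2 e3
    exact one (nz _ _ e0 (by simpa using h6)) (nz _ _ e1 (by simpa using h6))
      (nz _ _ e2 (by simpa using h6)) (nz _ _ e3 (by simpa using h6))
  · have : p 6 = 1 := by simpa [NormPt, h4, h5] using hN
    exact mk' 5 (p 7) (by simpa [pJ, pK]) (by simpa [pJ, pK]) (by simpa [pJ, pK]) (by simp [pJ, pK])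
  · exfalso; simp only [h4, h6, h7] at e0 e1 e2 e3
    exact one (nz _ _ e0 (by simpa using h5)) (nz _ _ e1 (by simpa using h5))
      (nz _ _ e2 (by simpa using h5)) (nz _ _ e3 (by simpa using h5))
  · have : p 5 = 1 := by simpa [NormPt, h4, h5] using hN
    exact mk' 4 (p 7) (by simpa [pJ, pK]) (by simpa [pJ, pK]) (by simpa [pJ, pK]) (by simp [pJ, pK])
  · have : p 5 = 1 := by simpa [NormPt, h4, h5] using hN
    exact mk' 3 (p 6) (by simpa [pJ, pK]) (by simpa [pJ, pK]) (by simp [pJ, pK]) (by simpa [pJ, pK])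
  · exfalso
    have q1 := cancel _ _ m1 h5
    have q2 := cancel _ _ m2 h6
    have q3 := cancel _ _ m3 h7
    have r1 : b = a := by linear_combination (-q1 - q3) / 2
    have r2 : c = a := by linear_combination (-q2 - q3) / 2
    have r3 : d = a := by linear_combination (-q1 - q2) / 2
    exact three a rfl (by rw [r1]) (by rw [r2]) (by rw [r3])
  · exfalso; simp only [h5, h6, h7] at e0 e1 e2 e3
    exact one (nz _ _ e0 (by simpa using h4)) (nz _ _ e1 (by simpa using h4))
      (nz _ _ e2 (by simpa using h4)) (nz _ _ e3 (by simpa using h4))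
  · have : p 4 = 1 := by simpa [NormPt, h4] using hN
    exact mk' 2 (p 7) (by simpa [pJ, pK]) (by simpa [pJ, pK]) (by simpa [pJ, pK]) (by simp [pJ, pK])
  · have : p 4 = 1 := by simpa [NormPt, h4] using hN
    exact mk' 1 (p 6) (by simpa [pJ, pK]) (by simpa [pJ, pK]) (by simp [pJ, pK]) (by simpa [pJ, pK])
  · exfalso
    have q0 := cancel _ _ m0 h4
    have q2 := cancel _ _ m2 h6
    have q3 := cancel _ _ m3 h7
    have r1 : b = -a := by linear_combination (q0 + q2) / 2
    have r2 : c = a := by linear_combination (-q2 - q3) / 2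
    have r3 : d = -a := by linear_combination (q0 + q3) / 2
    exact three a rfl (by rw [r1]; ring) (by rw [r2]) (by rw [r3]; ring)
  · have : p 4 = 1 := by simpa [NormPt, h4] using hN
    exact mk' 0 (p 5) (by simpa [pJ, pK]) (by simp [pJ, pK]) (by simpa [pJ, pK]) (by simpa [pJ, pK])
  · exfalso
    have q0 := cancel _ _ m0 h4
    have q1 := cancel _ _ m1 h5
    have q3 := cancel _ _ m3 h7
    have r1 : b = a := by linear_combination (-q1 - q3) / 2
    have r2 : c = -a := by linear_combination (q0 + q1) / 2
    have r3 : d = -a := by linear_combination (q0 + q3) / 2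
    exact three a rfl (by rw [r1]) (by rw [r2]; ring) (by rw [r3]; ring)
  · exfalso
    have q0 := cancel _ _ m0 h4
    have q1 := cancel _ _ m1 h5
    have q2 := cancel _ _ m2 h6
    have r1 : b = -a := by linear_combination (q0 + q2) / 2
    have r2 : c = -a := by linear_combination (q0 + q1) / 2
    have r3 : d = a := by linear_combination (-q1 - q2) / 2
    exact three a rfl (by rw [r1]; ring) (by rw [r2]; ring) (by rw [r3])
  · exfalso
    exact hne (had_zero (cancel _ _ m0 h4) (cancel _ _ m1 h5) (cancel _ _ m2 h6) (cancel _ _ m3 h7))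

lemma sing_of_good (p : Fin 8 → ℂ) (t x) (h : Good p t x) : IsSingPt p ∧ NormPt p := by
  obtain ⟨hx, hX, hY⟩ := h
  rw [sing_iff]
  have kill : ∀ y e f g : ℂ, e ^ 2 = 1 → f ^ 2 = 1 → y ^ 2 = e + f * x ^ 2 →
      g * (e - f * x ^ 2) * y = 0 := by
    intro y e f g he hf hy
    have : (g * (e - f * x ^ 2) * y) ^ 2 = 0 := by
      rw [mul_pow, hy]
      linear_combination g ^ 2 * (e - f * x ^ 2) * (he - x ^ 4 * hf - hx)
    simpa using this
  have x4 : p 4 = _ := hX 0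
  have x5 : p 5 = _ := hX 1
  have x6 : p 6 = _ := hX 2
  have x7 : p 7 = _ := hX 3
  have y0 : p 0 ^ 2 = _ := hY 0
  have y1 : p 1 ^ 2 = _ := hY 1
  have y2 : p 2 ^ 2 = _ := hY 2
  have y3 : p 3 ^ 2 = _ := hY 3
  have hsq : ∀ i j, (hs i j : ℂ) ^ 2 = 1 := by
    have : ∀ i j, hs i j ^ 2 = 1 := by decide
    intro i j
    exact_mod_cast this i j
  have hN : NormPt p := by
    unfold NormPt
    rw [x4, x5, x6]
    fin_cases t <;> simp [pJ, pK]
  refine ⟨⟨?_, ?_, ?_⟩, hN⟩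
  · rintro rfl
    simp [NormPt] at hN
  · rw [y0, y1, y2, y3, x4, x5, x6, x7]
    fin_cases t <;> simp [pJ, pK, hs] <;> ring_nf <;> simp
  · have k0 := fun g => kill _ _ _ g (hsq _ _) (hsq _ _) y0
    have k1 := fun g => kill _ _ _ g (hsq _ _) (hsq _ _) y1
    have k2 := fun g => kill _ _ _ g (hsq _ _) (hsq _ _) y2
    have k3 := fun g => kill _ _ _ g (hsq _ _) (hsq _ _) y3
    have nz : ∀ g : Fin 4 → ℂ, (∀ i, g i ≠ 0) → 
        (∃ i i', hs i (pJ t) * hs i (pK t) = 1 ∧ hs i' (pJ t) * hs i' (pK t) = -1) → 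
        ¬ (g 0 * (hs 0 (pJ t) - hs 0 (pK t) * x ^ 2) = 0 ∧ g 1 * (hs 1 (pJ t) - hs 1 (pK t) * x ^ 2) = 0
         ∧ g 2 * (hs 2 (pJ t) - hs 2 (pK t) * x ^ 2) = 0 ∧ g 3 * (hs 3 (pJ t) - hs 3 (pK t) * x ^ 2) = 0) := by
      rintro g hg ⟨i, i', h1, h2⟩ ⟨z0, z1, z2, z3⟩
      have z : ∀ i, (hs i (pJ t) : ℂ) - hs i (pK t) * x ^ 2 = 0 := by
        intro i
        refine (mul_eq_zero.1 (?_ : g i * _ = 0)).resolve_left (hg i)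
        fin_cases i <;> assumption
      have h1' : (hs i (pJ t) : ℂ) * hs i (pK t) = 1 := by exact_mod_cast h1
      have h2' : (hs i' (pJ t) : ℂ) * hs i' (pK t) = -1 := by exact_mod_cast h2
      have a1 : x ^ 2 = 1 := by
        linear_combination h1' - hs i (pK t) * z i - x ^ 2 * hsq i (pK t)
      have a2 : x ^ 2 = -1 := by
        linear_combination h2' - hs i' (pK t) * z i' - x ^ 2 * hsq i' (pK t)
      rw [a1] at a2
      norm_num at a2
    have ex : ∀ t, ∃ i i', hs i (pJ t) * hs i (pK t) = 1 ∧ hs i' (pJ t) * hs i' (pK t) = -1 := by decide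
    -- the weights: another column of the sign matrix
    let w : Fin 6 → Fin 4 := ![2, 1, 1, 1, 1, 2]
    refine ⟨(hs 0 (w t)) * (hs 0 (pJ t) - hs 0 (pK t) * x ^ 2),
      (hs 1 (w t)) * (hs 1 (pJ t) - hs 1 (pK t) * x ^ 2),
      (hs 2 (w t)) * (hs 2 (pJ t) - hs 2 (pK t) * x ^ 2),
      (hs 3 (w t)) * (hs 3 (pJ t) - hs 3 (pK t) * x ^ 2),
      nz (fun i => (hs i (w t) : ℂ)) (fun i h => ?_) (ex t), k0 _, k1 _, k2 _, k3 _, ?_⟩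
    · have := hsq i (w t)
      rw [show (hs i (w t) : ℂ) = 0 from h] at this
      norm_num at this
    · rw [x4, x5, x6, x7]
      fin_cases t <;> simp [pJ, pK, hs, w] <;> ring_nf <;> simp

lemma norm_inj (p q : Fin 8 → ℂ) (hp : NormPt p) (hq : NormPt q)
    (h : Submodule.span ℂ {p} = Submodule.span ℂ {q}) : p = q := by
  have : p ∈ Submodule.span ℂ {q} := h ▸ Submodule.mem_span_singleton_self p
  obtain ⟨c, rfl⟩ := Submodule.mem_span_singleton.1 this
  have hc : c = 1 := by
    simp only [NormPt, Pi.smul_apply, smul_eq_mul] at hp hq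
    rcases hq with h | ⟨h, h'⟩ | ⟨h, h', h''⟩
    · rw [h] at hp; by_contra hc
      rcases hp with hp | ⟨hp, hp'⟩ | ⟨hp, hp', hp''⟩ <;> simp_all
    · rw [h, h'] at hp; by_contra hc
      rcases hp with hp | ⟨hp, hp'⟩ | ⟨hp, hp', hp''⟩ <;> simp_all
    · simp_all
  simp [hc]

lemma norm_exists (p : Fin 8 → ℂ) (hp : IsSingPt p) :
    ∃ q, IsSingPt q ∧ NormPt q ∧ Submodule.span ℂ {p} = Submodule.span ℂ {q} := by
  have key : ∀ c : ℂ, c ≠ 0 → IsSingPt (c • p) := by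
    intro k hk
    rw [sing_iff] at hp ⊢
    obtain ⟨h0, ⟨e0, e1, e2, e3⟩, a, b, c, d, hne, ha, hb, hc, hd, m0, m1, m2, m3⟩ := hp
    refine ⟨smul_ne_zero hk h0, ?_, a, b, c, d, hne, ?_⟩
    · simp only [Pi.smul_apply, smul_eq_mul, mul_pow, e0, e1, e2, e3]
      refine ⟨?_, ?_, ?_, ?_⟩ <;> ring
    · simp only [Pi.smul_apply, smul_eq_mul, mul_left_comm _ k, ha, hb, hc, hd, m0, m1, m2, m3, mul_zero, and_self]
  have sp : ∀ c : ℂ, c ≠ 0 → Submodule.span ℂ {p} = Submodule.span ℂ {c • p} := by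
    intro c hc
    exact (Submodule.span_singleton_smul_eq (IsUnit.mk0 c hc) p).symm
  by_cases h4 : p 4 = 0
  · by_cases h5 : p 5 = 0
    · by_cases h6 : p 6 = 0
      · exfalso
        rw [sing_iff] at hp
        obtain ⟨h0, ⟨e0, e1, e2, e3⟩, a, b, c, d, hne, ha, hb, hc, hd, m0, m1, m2, m3⟩ := hp
        by_cases h7 : p 7 = 0
        · apply h0
          simp only [h4, h5, h6, h7] at e0 e1 e2 e3
          ext i
          fin_cases i <;> simp_all
        · apply hne
          have z0 : p 0 ≠ 0 := by
            intro h; apply h7; simpa [h, h4, h5, h6] using e0.symm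
          have z1 : p 1 ≠ 0 := by
            intro h; apply h7; simpa [h, h4, h5, h6] using e1
          have z2 : p 2 ≠ 0 := by
            intro h; apply h7; simpa [h, h4, h5, h6] using e2
          have z3 : p 3 ≠ 0 := by
            intro h; apply h7; simpa [h, h4, h5, h6] using e3.symm
          exact ⟨(mul_eq_zero.1 ha).resolve_right z0, (mul_eq_zero.1 hb).resolve_right z1,
            (mul_eq_zero.1 hc).resolve_right z2, (mul_eq_zero.1 hd).resolve_right z3⟩
      · exact ⟨_, key _ (inv_ne_zero h6), by simp [NormPt, h4, h5, h6], sp _ (inv_ne_zero h6)⟩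
    · exact ⟨_, key _ (inv_ne_zero h5), by simp [NormPt, h4, h5], sp _ (inv_ne_zero h5)⟩
  · exact ⟨_, key _ (inv_ne_zero h4), by simp [NormPt, h4], sp _ (inv_ne_zero h4)⟩

/-- values of the codes -/
noncomputable def cv : Fin 5 → ℂ := ![0, 1, Complex.I, -1, -Complex.I]

lemma cv_inj : Function.Injective cv := by
  intro a b h
  have hr := congrArg Complex.re h
  have hi := congrArg Complex.im h
  fin_cases a <;> fin_cases b <;> first | rfl | (exfalso; norm_num [cv] at hr; done) | (exfalso; norm_num [cv] at hi)

/-- decode -/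
noncomputable def decodePt (c : Fin 8 → Fin 5) : Fin 8 → ℂ :=
  fun i => if i < 4 then (Real.sqrt 2 : ℂ) * cv (c i) else cv (c i)

lemma sqrt_two_sq : (Real.sqrt 2 : ℂ) ^ 2 = 2 := by
  rw [← Complex.ofReal_pow]; norm_num

lemma sqrt_two_ne : (Real.sqrt 2 : ℂ) ≠ 0 := by
  intro h; have := sqrt_two_sq; rw [h] at this; norm_num at this

lemma decode_inj : Function.Injective decodePt := by
  intro a b h
  ext1 i
  have := congrFun h i
  unfold decodePt at this
  split_ifs at this
  · exact cv_inj (mul_left_cancel₀ sqrt_two_ne this)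
  · exact cv_inj this

/-- sign of `x^2` for `x = cv u.succ` -/
def usq : Fin 4 → ℤ := ![1, -1, 1, -1]

/-- square root codes of `0, 2, -2` -/
def rt (n : ℤ) (e : Bool) : Fin 5 :=
  if n = 0 then 0 else if n = 2 then (if e then 1 else 3) else (if e then 2 else 4)

/-- the codes -/
def code (w : Fin 6 × Fin 4 × (Fin 4 → Bool)) : Fin 8 → Fin 5 :=
  Fin.append (fun i : Fin 4 => rt (hs i (pJ w.1) + hs i (pK w.1) * usq w.2.1) (w.2.2 i))
    (fun m : Fin 4 => if m = pJ w.1 then 1 else if m = pK w.1 then w.2.1.succ else 0)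

/-- canonical parameters: the unused sign choices are set to `false` -/
def Canon (w : Fin 6 × Fin 4 × (Fin 4 → Bool)) : Prop :=
  ∀ i : Fin 4, hs i (pJ w.1) + hs i (pK w.1) * usq w.2.1 = 0 → w.2.2 i = false

instance : DecidablePred Canon := fun w => by unfold Canon; infer_instance

/-- the pair of nonzero coordinates, read off from a code -/
def codePair (c : Fin 8 → Fin 5) : Fin 6 :=
  if c 4 ≠ 0 then (if c 5 ≠ 0 then 0 else if c 6 ≠ 0 then 1 else 2)
  else if c 5 ≠ 0 then (if c 6 ≠ 0 then 3 else 4) else 5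

/-- the parameters, read off from a code -/
def decodeParam (c : Fin 8 → Fin 5) : Fin 6 × Fin 4 × (Fin 4 → Bool) :=
  (codePair c, (![0, 0, 1, 2, 3] : Fin 5 → Fin 4) (c (Fin.natAdd 4 (pK (codePair c)))),
    fun i => decide (c (Fin.castAdd 4 i) = 1 ∨ c (Fin.castAdd 4 i) = 2))

lemma decodeParam_code : ∀ w, Canon w → decodeParam (code w) = w := by
  decide +kernel

lemma canon_card : (Finset.univ.filter Canon).card = 96 := by
  decide +kernel

lemma code_card : (Finset.univ.image code).card = 96 := by
  have h : Finset.univ.image code = (Finset.univ.filter Canon).image code := by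
    ext c
    simp only [Finset.mem_image, Finset.mem_univ, true_and, Finset.mem_filter]
    constructor
    · rintro ⟨⟨t, u, e⟩, rfl⟩
      refine ⟨(t, u, fun i => if hs i (pJ t) + hs i (pK t) * usq u = 0 then false else e i),
        fun i hi => if_pos hi, ?_⟩
      unfold code
      congr 1
      ext1 i
      dsimp only
      split_ifs with hi
      · simp [rt, hi]
      · rfl
    · rintro ⟨w, -, rfl⟩
      exact ⟨w, rfl⟩
  rw [h, Finset.card_image_of_injOn, canon_card]
  intro a ha b hb hab
  simp only [Finset.coe_filter, Finset.mem_univ, true_and, Set.mem_ofPred_eq] at ha hb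
  rw [← decodeParam_code a ha, ← decodeParam_code b hb, hab]

lemma usq_eq (u : Fin 4) : cv u.succ ^ 2 = usq u := by
  fin_cases u <;> simp [cv, usq]

lemma root_exists (x : ℂ) (h : x ^ 4 = 1) : ∃ u : Fin 4, x = cv u.succ := by
  have : (x - 1) * ((x - Complex.I) * ((x + 1) * (x + Complex.I))) = 0 := by
    linear_combination h - (x ^ 2 - 1) * Complex.I_sq
  simp only [mul_eq_zero] at this
  rcases this with h | h | h | h
  · exact ⟨0, by simp [cv]; linear_combination h⟩
  · exact ⟨1, by simp [cv]; linear_combination h⟩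
  · exact ⟨2, by simp [cv]; linear_combination h⟩
  · exact ⟨3, by simp [cv]; linear_combination h⟩

lemma n_cases : ∀ (i : Fin 4) (t : Fin 6) (u : Fin 4),
    hs i (pJ t) + hs i (pK t) * usq u = 0 ∨ hs i (pJ t) + hs i (pK t) * usq u = 2 ∨
    hs i (pJ t) + hs i (pK t) * usq u = -2 := by decide

lemma rt_sq (n : ℤ) (e : Bool) (h : n = 0 ∨ n = 2 ∨ n = -2) :
    ((Real.sqrt 2 : ℂ) * cv (rt n e)) ^ 2 = n := by
  rw [mul_pow, sqrt_two_sq]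
  rcases h with rfl | rfl | rfl <;> cases e <;> simp [rt, cv]

lemma rt_exists (n : ℤ) (y : ℂ) (h : n = 0 ∨ n = 2 ∨ n = -2) (hy : y ^ 2 = n) :
    ∃ e, y = (Real.sqrt 2 : ℂ) * cv (rt n e) := by
  have h1 := rt_sq n true h
  rw [← hy] at h1
  rcases sq_eq_sq_iff_eq_or_eq_neg.1 h1 with h2 | h2
  · exact ⟨true, h2.symm⟩
  · refine ⟨false, ?_⟩
    rw [← neg_eq_iff_eq_neg] at h2
    rw [← h2]
    rcases h with rfl | rfl | rfl <;> simp [rt, cv]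

lemma good_iff (p : Fin 8 → ℂ) : (∃ t x, Good p t x) ↔ ∃ w, decodePt (code w) = p := by
  have lt4 : ∀ i : Fin 4, Fin.castAdd 4 i < (4 : Fin 8) := by decide
  have nlt4 : ∀ i : Fin 4, ¬ Fin.natAdd 4 i < (4 : Fin 8) := by decide
  constructor
  · rintro ⟨t, x, hx, hX, hY⟩
    obtain ⟨u, rfl⟩ := root_exists x hx
    have : ∀ i : Fin 4, ∃ e, p (Fin.castAdd 4 i) =
        (Real.sqrt 2 : ℂ) * cv (rt (hs i (pJ t) + hs i (pK t) * usq u) e) := by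
      intro i
      apply rt_exists _ _ (n_cases i t u)
      rw [hY, usq_eq]; push_cast; rfl
    choose e he using this
    refine ⟨(t, u, e), ?_⟩
    ext1 i
    refine Fin.addCases (m := 4) (n := 4) (fun i => ?_) (fun i => ?_) i
    · rw [he]; unfold decodePt code; rw [if_pos (lt4 i), Fin.append_left]
    · rw [hX]; unfold decodePt code; rw [if_neg (nlt4 i), Fin.append_right]
      dsimp only
      split_ifs <;> simp [cv]
  · rintro ⟨⟨t, u, e⟩, rfl⟩
    refine ⟨t, cv u.succ, ?_, fun i => ?_, fun i => ?_⟩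
    · rw [show cv u.succ ^ 4 = (cv u.succ ^ 2) ^ 2 by ring, usq_eq]; fin_cases u <;> simp [usq]
    · unfold decodePt code; rw [if_neg (nlt4 i), Fin.append_right]
      dsimp only
      split_ifs <;> simp [cv]
    · unfold decodePt code; rw [if_pos (lt4 i), Fin.append_left, rt_sq _ _ (n_cases i t u), usq_eq]
      push_cast; rfl

/-- The set of singular points of `𝒳`, i.e. the set of complex lines `ℂ·p`
spanned by nonzero singular points `p` of `C𝒳`, has exactly `96` elements. -/
theorem singular_locus_has_96_points :
    {L : Submodule ℂ (Fin 8 → ℂ) | ∃ p, IsSingPt p ∧ L = Submodule.span ℂ {p}}.Finite ∧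
    {L : Submodule ℂ (Fin 8 → ℂ) | ∃ p, IsSingPt p ∧ L = Submodule.span ℂ {p}}.ncard = 96 := by
  classical
  have hset : {L : Submodule ℂ (Fin 8 → ℂ) | ∃ p, IsSingPt p ∧ L = Submodule.span ℂ {p}} =
      (fun c => Submodule.span ℂ {decodePt c}) '' (Finset.univ.image code : Finset (Fin 8 → Fin 5)) := by
    ext L
    simp only [Set.mem_ofPred_eq, Finset.coe_image, Finset.coe_univ, Set.image_univ, Set.mem_image,
      Set.mem_range]
    constructor
    · rintro ⟨p, hp, rfl⟩
      obtain ⟨q, hq, hN, he⟩ := norm_exists p hp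
      obtain ⟨w, hw⟩ := (good_iff q).1 (good_of_sing q hq hN)
      exact ⟨code w, ⟨w, rfl⟩, by rw [he, hw]⟩
    · rintro ⟨_, ⟨w, rfl⟩, rfl⟩
      obtain ⟨t, x, h⟩ := (good_iff _).2 ⟨w, rfl⟩
      exact ⟨_, (sing_of_good _ t x h).1, rfl⟩
  have hinj : Set.InjOn (fun c => Submodule.span ℂ {decodePt c})
      (Finset.univ.image code : Finset (Fin 8 → Fin 5)) := by
    intro a ha b hb hab
    simp only [Finset.coe_image, Finset.coe_univ, Set.image_univ, Set.mem_range] at ha hb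
    obtain ⟨w, rfl⟩ := ha
    obtain ⟨v, rfl⟩ := hb
    obtain ⟨t, x, h⟩ := (good_iff _).2 ⟨w, rfl⟩
    obtain ⟨t', x', h'⟩ := (good_iff _).2 ⟨v, rfl⟩
    exact decode_inj (norm_inj _ _ (sing_of_good _ t x h).2 (sing_of_good _ t' x' h').2 hab)
  rw [hset]
  refine ⟨(Finset.finite_toSet _).image _, ?_⟩
  rw [Set.InjOn.ncard_image hinj, Set.ncard_coe_finset, code_card]
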